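/- For all i, j ∈ {1,…,n+1} one has u_j(x_i) = δ_ij / ⟨1|u_i⟩; that is, the orthonormal eigenvectors u_i are proportional to the Lagrange cardinal functions for the points x_1,…,x_{n+1}. -/

import Mathlib

open Polynomial MeasureTheory

/-- Integration of polynomials against a weight continuous on `[a, b]`, as a linear functional. -/
noncomputable def weightedIntegral (a b : ℝ) (w : ℝ → ℝ) (hw : ContinuousOn w (Set.uIcc a b)) :
    ℝ[X] →ₗ[ℝ] ℝ where
  toFun p := ∫ t in a..b, w t * p.eval t
  map_add' p q := by
    have h (r : ℝ[X]) : IntervalIntegrable (fun t => w t * r.eval t) volume a b :=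
      (hw.mul r.continuous.continuousOn).intervalIntegrable
    simp only [eval_add, mul_add]
    exact intervalIntegral.integral_add (h p) (h q)
  map_smul' c p := by
    simp [mul_left_comm]

/-- Polynomials of degree at most `n` that are orthonormal for the form `p, q ↦ L (p * q)`
and indexed by `Fin (n + 1)` span all polynomials of degree at most `n`. -/
theorem span_range_eq_degreeLT_of_orthonormal {n : ℕ} (L : ℝ[X] →ₗ[ℝ] ℝ)
    (u : Fin (n + 1) → ℝ[X]) (hdeg : ∀ i, (u i).natDegree ≤ n)
    (horth : ∀ i j, L (u i * u j) = if i = j then 1 else 0) :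
    Submodule.span ℝ (Set.range u) = degreeLT ℝ (n + 1) := by
  have hindep : LinearIndependent ℝ u := by
    rw [Fintype.linearIndependent_iff]
    intro g hg k
    simpa [Finset.sum_mul, horth] using congrArg (fun p => L (p * u k)) hg
  have : Module.Finite ℝ (degreeLT ℝ (n + 1)) :=
    Module.Finite.equiv (degreeLTEquiv ℝ (n + 1)).symm
  refine Submodule.eq_of_le_of_finrank_eq (Submodule.span_le.2 ?_) ?_
  · rintro _ ⟨i, rfl⟩
    exact mem_degreeLT.2 (degree_le_natDegree.trans_lt
      (by exact_mod_cast Nat.lt_succ_of_le (hdeg i)))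
  · rw [finrank_span_eq_card hindep, (degreeLTEquiv ℝ (n + 1)).finrank_eq]
    simp

/-- An eigenvector `u i` of the compression of multiplication by `X` represents evaluation at its
eigenvalue, up to the factor `L (u i)`. -/
theorem apply_mul_eq_eval_mul {n : ℕ} (L : ℝ[X] →ₗ[ℝ] ℝ)
    (u : Fin (n + 1) → ℝ[X]) (x : Fin (n + 1) → ℝ) (hdeg : ∀ i, (u i).natDegree ≤ n)
    (horth : ∀ i j, L (u i * u j) = if i = j then 1 else 0)
    (heig : ∀ i j, L (X * u i * u j) = if i = j then x i else 0)
    (i : Fin (n + 1)) {p : ℝ[X]} (hp : p.natDegree ≤ n) :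
    L (p * u i) = p.eval (x i) * L (u i) := by
  have hvanish (q : ℝ[X]) (hq : q.natDegree ≤ n) : L ((X - C (x i)) * q * u i) = 0 := by
    have hmem : q ∈ Submodule.span ℝ (Set.range u) := by
      rw [span_range_eq_degreeLT_of_orthonormal L u hdeg horth, mem_degreeLT]
      exact degree_le_natDegree.trans_lt (by exact_mod_cast Nat.lt_succ_of_le hq)
    clear hq
    induction hmem using Submodule.span_induction with
    | mem _ h =>
      obtain ⟨k, rfl⟩ := h
      have hsplit : (X - C (x i)) * u k * u i = X * u k * u i - x i • (u k * u i) := by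
        rw [smul_eq_C_mul]; ring
      rw [hsplit, map_sub, map_smul, heig, horth]
      split_ifs with h <;> simp [h]
    | zero => simp
    | add q r _ _ hq hr => rw [mul_add, add_mul, map_add, hq, hr, add_zero]
    | smul c q _ hq => rw [mul_smul_comm, smul_mul_assoc, map_smul, hq, smul_zero]
  have hdiv := modByMonic_add_div p (X - C (x i))
  rw [modByMonic_X_sub_C_eq_C_eval] at hdiv
  have hq : (p /ₘ (X - C (x i))).natDegree ≤ n := by
    rw [natDegree_divByMonic _ (monic_X_sub_C _)]
    omega
  calc L (p * u i)
      = L (p.eval (x i) • u i + (X - C (x i)) * (p /ₘ (X - C (x i))) * u i) := by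
        rw [smul_eq_C_mul, ← add_mul, hdiv]
    _ = p.eval (x i) * L (u i) := by
        rw [map_add, map_smul, hvanish _ hq, add_zero, smul_eq_mul]

/-- `u_j(x_i) = δ_ij / ⟨1|u_i⟩`: the orthonormal eigenvectors are proportional
to the Lagrange cardinal functions for the points `x_1,…,x_{n+1}`. -/
theorem eigenvectors_are_cardinal_functions
(n : ℕ) (a b : ℝ) (hab : a < b)
    (w : ℝ → ℝ) (hw_cont : ContinuousOn w (Set.Icc a b))
    (hw_pos : ∀ t ∈ Set.Ioo a b, 0 < w t)
    (u : Fin (n + 1) → Polynomial ℝ) (hu_deg : ∀ i, (u i).natDegree ≤ n)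
    (x : Fin (n + 1) → ℝ)
    (horth : ∀ i j, (∫ t in a..b, w t * (u i).eval t * (u j).eval t)
      = if i = j then 1 else 0)
    (heig : ∀ i j, (∫ t in a..b, w t * t * (u i).eval t * (u j).eval t)
      = if i = j then x i else 0)
    (i j : Fin (n + 1)) :
    (u j).eval (x i)
      = (if i = j then 1 else 0) / (∫ t in a..b, w t * (u i).eval t) := by
  have hw : ContinuousOn w (Set.uIcc a b) := by rwa [Set.uIcc_of_le hab.le]
  set L := weightedIntegral a b w hw
  have hL (p : ℝ[X]) : L p = ∫ t in a..b, w t * p.eval t := rfl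
  have horth' (k l) : L (u k * u l) = if k = l then 1 else 0 := by
    simp [hL, ← horth, mul_assoc]
  have heig' (k l) : L (X * u k * u l) = if k = l then x k else 0 := by
    simp [hL, ← heig, mul_assoc]
  have heval (k) := apply_mul_eq_eval_mul L u x hu_deg horth' heig' i (hu_deg k)
  have hne : L (u i) ≠ 0 := by
    intro h
    simpa [horth', h] using heval i
  rw [← hL, eq_div_iff hne, ← heval j, horth']
  simp only [eq_comm]
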